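/- (Non-degeneracy II, item 1.) The map κ ↦ (ω⃗(κ), 1) from [κ₁, κ₂] to ℝ^{ν+1} is non-degenerate: for every (c, d) ∈ ℝ^ν × ℝ with (c, d) ≠ 0 there exists κ ∈ [κ₁, κ₂] such that Σ_{a=1}^{ν} c_a · ω_{j̄_a}(κ) + d ≠ 0. -/

import Mathlib

open Real Finset Set

/-- `G_j := j · tanh(dpt · j)` (finite depth `dpt`). -/
noncomputable def Gfun (dpt : ℝ) (j : ℤ) : ℝ := (j : ℝ) * Real.tanh (dpt * (j : ℝ))

/-- The linear frequencies `ω_j(κ)`. -/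
noncomputable def omegaF (dpt g γ : ℝ) (j : ℤ) (κ : ℝ) : ℝ :=
  Real.sqrt (κ * Gfun dpt j * (j : ℝ) ^ 2 + g * Gfun dpt j + (γ * Gfun dpt j / (2 * (j : ℝ))) ^ 2)

/-- The linear frequencies `Ω_j(κ) = ω_j(κ) + (γ/2) G_j / j`. -/
noncomputable def OmegaF (dpt g γ : ℝ) (j : ℤ) (κ : ℝ) : ℝ :=
  omegaF dpt g γ j κ + γ / 2 * Gfun dpt j / (j : ℝ)

theorem convexOn_sinh_Ici : ConvexOn ℝ (Set.Ici 0) Real.sinh := by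
  refine convexOn_of_deriv2_nonneg (convex_Ici 0) Real.continuous_sinh.continuousOn
    Real.differentiable_sinh.differentiableOn ?_ ?_
  · rw [Real.deriv_sinh]
    exact Real.differentiable_cosh.differentiableOn
  · intro x hx
    rw [interior_Ici] at hx
    simpa using (Set.mem_Ioi.mp hx).le

theorem mul_sinh_le_mul_sinh {t s : ℝ} (ht : 0 ≤ t) (hs : 0 < s) (hts : t ≤ s) :
    s * Real.sinh t ≤ t * Real.sinh s := by
  have h := convexOn_sinh_Ici.2 (Set.mem_Ici.mpr hs.le) (Set.mem_Ici.mpr le_rfl)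
    (div_nonneg ht hs.le) (sub_nonneg.mpr ((div_le_one hs).mpr hts)) (by ring)
  simp only [smul_eq_mul, mul_zero, add_zero, Real.sinh_zero, div_mul_cancel₀ t hs.ne'] at h
  calc s * Real.sinh t ≤ s * (t / s * Real.sinh s) := by gcongr
    _ = t * Real.sinh s := by field_simp

theorem mul_tanh_le_mul_tanh {x y : ℝ} (hx : 0 < x) (hxy : x ≤ y) :
    x * Real.tanh y ≤ y * Real.tanh x := by
  have h := mul_sinh_le_mul_sinh (sub_nonneg.mpr hxy) (by linarith : 0 < y + x) (by linarith)
  rw [Real.sinh_sub, Real.sinh_add] at h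
  rw [Real.tanh_eq_sinh_div_cosh, Real.tanh_eq_sinh_div_cosh, mul_div_assoc', mul_div_assoc',
    div_le_div_iff₀ (Real.cosh_pos y) (Real.cosh_pos x)]
  linarith

theorem tanh_pos_of_pos {x : ℝ} (hx : 0 < x) : 0 < Real.tanh x := by
  rw [Real.tanh_eq_sinh_div_cosh]
  exact div_pos (Real.sinh_pos_iff.mpr hx) (Real.cosh_pos x)

/-- The shift `B / A` of a frequency `√(A κ + B)`, as a function of the absolute value of the
wave number. -/
noncomputable def freqShift (dpt g γ x : ℝ) : ℝ :=
  g / x ^ 2 + γ ^ 2 / 4 * (Real.tanh (dpt * x) / x ^ 3)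

theorem freqShift_pos {dpt g γ x : ℝ} (hdpt : 0 < dpt) (hg : 0 < g) (hx : 0 < x) :
    0 < freqShift dpt g γ x := by
  have := tanh_pos_of_pos (mul_pos hdpt hx)
  unfold freqShift
  positivity

theorem freqShift_strictAntiOn {dpt g : ℝ} (γ : ℝ) (hdpt : 0 < dpt) (hg : 0 < g) :
    StrictAntiOn (freqShift dpt g γ) (Set.Ioi 0) := by
  intro x hx y hy hxy
  rw [Set.mem_Ioi] at hx hy
  have hT := tanh_pos_of_pos (mul_pos hdpt hx)
  have h1 : g / y ^ 2 < g / x ^ 2 := by gcongr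
  have h2 : Real.tanh (dpt * y) / y ^ 3 ≤ Real.tanh (dpt * x) / x ^ 3 := by
    have h := mul_tanh_le_mul_tanh (mul_pos hdpt hx) (mul_le_mul_of_nonneg_left hxy.le hdpt.le)
    have h' : x * Real.tanh (dpt * y) ≤ y * Real.tanh (dpt * x) :=
      le_of_mul_le_mul_left (by linarith) hdpt
    have hT' := tanh_pos_of_pos (mul_pos hdpt hy)
    rw [div_le_div_iff₀ (by positivity) (by positivity)]
    calc Real.tanh (dpt * y) * x ^ 3 = x ^ 2 * (x * Real.tanh (dpt * y)) := by ring
      _ ≤ y ^ 2 * (y * Real.tanh (dpt * x)) := by gcongr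
      _ = Real.tanh (dpt * x) * y ^ 3 := by ring
  have h3 := mul_le_mul_of_nonneg_left h2 (by positivity : 0 ≤ γ ^ 2 / 4)
  unfold freqShift
  linarith

theorem Gfun_eq_abs (dpt : ℝ) (j : ℤ) :
    Gfun dpt j = |(j : ℝ)| * Real.tanh (dpt * |(j : ℝ)|) := by
  unfold Gfun
  rcases abs_choice (j : ℝ) with h | h <;> rw [h]
  rw [mul_neg, Real.tanh_neg]
  ring

theorem Gfun_pos {dpt : ℝ} (hdpt : 0 < dpt) {j : ℤ} (hj : j ≠ 0) : 0 < Gfun dpt j := by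
  have hj' : 0 < |(j : ℝ)| := abs_pos.mpr (Int.cast_ne_zero.mpr hj)
  rw [Gfun_eq_abs]
  exact mul_pos hj' (tanh_pos_of_pos (mul_pos hdpt hj'))

theorem omegaF_eq {dpt : ℝ} (g γ : ℝ) (hdpt : 0 < dpt) {j : ℤ} (hj : j ≠ 0) (κ : ℝ) :
    omegaF dpt g γ j κ =
      Real.sqrt (Gfun dpt j * (j : ℝ) ^ 2) *
        (κ + freqShift dpt g γ |(j : ℝ)|) ^ (1 / 2 : ℝ) := by
  have hG := Gfun_pos hdpt hj
  have hj' : 0 < |(j : ℝ)| := abs_pos.mpr (Int.cast_ne_zero.mpr hj)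
  rw [← Real.sqrt_eq_rpow, ← Real.sqrt_mul (by positivity)]
  unfold omegaF freqShift
  congr 1
  rw [div_pow, mul_pow, mul_pow, ← sq_abs (j : ℝ), Gfun_eq_abs]
  field_simp
  ring

/-- If a combination of shifted powers is constant on an open interval, then the same combination
with the exponent lowered by one vanishes there. -/
theorem sum_mul_rpow_sub_one_eq_zero {ι : Type*} [Fintype ι] {a b s C : ℝ} (hs : s ≠ 0)
    {w r : ι → ℝ} (hr : ∀ i, ∀ κ ∈ Set.Ioo a b, 0 < κ + r i)
    (h : ∀ κ ∈ Set.Ioo a b, ∑ i, w i * (κ + r i) ^ s = C) :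
    ∀ κ ∈ Set.Ioo a b, ∑ i, w i * (κ + r i) ^ (s - 1) = 0 := by
  intro κ hκ
  have h1 : HasDerivAt (fun x => ∑ i, w i * (x + r i) ^ s)
      (∑ i, w i * (1 * s * (κ + r i) ^ (s - 1))) κ :=
    HasDerivAt.fun_sum fun i _ =>
      (((hasDerivAt_id κ).add_const (r i)).rpow_const (Or.inl (hr i κ hκ).ne')).const_mul (w i)
  have h2 : HasDerivAt (fun x => ∑ i, w i * (x + r i) ^ s) 0 κ :=
    (hasDerivAt_const κ C).congr_of_eventuallyEq
      (Filter.eventually_of_mem (isOpen_Ioo.mem_nhds hκ) h)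
  have h3 := h1.unique h2
  refine (mul_eq_zero.mp ?_).resolve_left hs
  rw [← h3, Finset.mul_sum]
  exact Finset.sum_congr rfl fun i _ => by ring

/-- Shifted square roots with distinct shifts, together with `1`, are linearly independent on
every nonempty open interval. -/
theorem eq_zero_of_sum_mul_sqrt_shift_eq_const {n : ℕ} {a b C : ℝ} (hab : a < b)
    {w r : Fin n → ℝ} (hinj : Function.Injective r)
    (hr : ∀ i, ∀ κ ∈ Set.Ioo a b, 0 < κ + r i)
    (h : ∀ κ ∈ Set.Ioo a b, ∑ i, w i * (κ + r i) ^ (1 / 2 : ℝ) = C) : w = 0 := by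
  have key : ∀ m : ℕ, ∀ κ ∈ Set.Ioo a b, ∑ i, w i * (κ + r i) ^ (-(1 / 2) - m : ℝ) = 0 := by
    intro m
    induction m with
    | zero =>
      have := sum_mul_rpow_sub_one_eq_zero (by norm_num) hr h
      norm_num at this ⊢
      exact this
    | succ m ih =>
      have hm : (-(1 / 2) - m : ℝ) ≠ 0 := by
        have : (0 : ℝ) ≤ m := m.cast_nonneg
        linarith
      have := sum_mul_rpow_sub_one_eq_zero hm hr ih
      rwa [show (-(1 / 2) - m - 1 : ℝ) = -(1 / 2) - (m + 1 : ℕ) by push_cast; ring] at this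
  obtain ⟨κ, hκ⟩ := Set.nonempty_Ioo.mpr hab
  have hv : (fun i => w i * (κ + r i) ^ (-(1 / 2) : ℝ)) = 0 := by
    refine Matrix.eq_zero_of_forall_pow_sum_mul_pow_eq_zero (f := fun i => (κ + r i)⁻¹)
      (fun i j hij => hinj (add_left_cancel (inv_injective hij))) fun m => ?_
    rw [← key m κ hκ]
    refine Finset.sum_congr rfl fun i _ => ?_
    rw [Real.rpow_sub (hr i κ hκ), Real.rpow_natCast, inv_pow, mul_assoc, ← div_eq_mul_inv]
  funext i
  exact (mul_eq_zero.mp (congrFun hv i)).resolve_right (Real.rpow_pos_of_pos (hr i κ hκ) _).ne'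

/-- Non-degeneracy II, item 1: the curve κ ↦ (ω⃗(κ), 1) is non-degenerate. -/
theorem nondegeneracy_II_item1
    (dpt g γ κ₁ κ₂ : ℝ) (hdpt : 0 < dpt) (hg : 0 < g) (hκ₁ : 0 < κ₁) (hκ₁₂ : κ₁ < κ₂)
    (ν : ℕ) (hν : 1 ≤ ν) (jbar : Fin ν → ℤ)
    (hjne : ∀ a, jbar a ≠ 0)
    (hjinj : Function.Injective fun a => |jbar a|) :
    ∀ (c : Fin ν → ℝ) (d : ℝ), (c ≠ 0 ∨ d ≠ 0) →
      ∃ κ ∈ Set.Icc κ₁ κ₂,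
        (∑ a, c a * omegaF dpt g γ (jbar a) κ) + d ≠ 0 := by
  intro c d hcd
  by_contra! hzero
  have hpos : ∀ a, 0 < |(jbar a : ℝ)| := fun a => abs_pos.mpr (Int.cast_ne_zero.mpr (hjne a))
  have hc : c = 0 := by
    have hw := eq_zero_of_sum_mul_sqrt_shift_eq_const (C := -d) hκ₁₂
      (w := fun a => c a * Real.sqrt (Gfun dpt (jbar a) * (jbar a : ℝ) ^ 2))
      (r := fun a => freqShift dpt g γ |(jbar a : ℝ)|)
      (fun a b hab => hjinj <| by
        have := (freqShift_strictAntiOn γ hdpt hg).injOn (hpos a) (hpos b) hab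
        exact_mod_cast this)
      (fun a κ hκ => add_pos (hκ₁.trans hκ.1) (freqShift_pos hdpt hg (hpos a)))
      (fun κ hκ => by
        rw [← add_eq_zero_iff_eq_neg, ← hzero κ (Set.Ioo_subset_Icc_self hκ)]
        congr 1
        refine Finset.sum_congr rfl fun a _ => ?_
        rw [omegaF_eq g γ hdpt (hjne a), mul_assoc])
    funext a
    refine (mul_eq_zero.mp (congrFun hw a)).resolve_right (Real.sqrt_pos.mpr ?_).ne'
    exact mul_pos (Gfun_pos hdpt (hjne a)) (pow_pos (hpos a) 2 |>.trans_eq (sq_abs _))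
  have hd := hzero κ₁ (Set.left_mem_Icc.mpr hκ₁₂.le)
  simp [hc] at hd
  exact hcd.elim (fun h => h hc) (fun h => h hd)
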